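/- Let c ∈ ℝ, ε > 0, and let G : [0, ε) → (0, ∞) be C² with derivatives extending continuously to 0. Suppose g(r) := G(r²) satisfies the Freud radial mean field equation for α = 2, namely 4πc r g(r) = 8 r³ + (r (log g)'(r))' for all r ∈ (0, √ε). Then the first two Taylor coefficients a₁ = (log G)'(0) and a₂ = ½ (log G)''(0) of log(g/g(0)) in the variable r² are given by a₁ = πc G(0) and a₂ = ¼ (πc G(0))² − 1/2. -/

import Mathlib

open Set Filter Topology

/-- A `C^{n+1}` function on `[0, ε)` has a `C^n` right derivative there. -/
theorem ContDiffOn.derivWithin_Ici_of_Ico {f : ℝ → ℝ} {ε : ℝ} {m n : WithTop ℕ∞}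
    (hf : ContDiffOn ℝ n f (Ico 0 ε)) (hmn : m + 1 ≤ n) :
    ContDiffOn ℝ m (derivWithin f (Ici 0)) (Ico 0 ε) := by
  refine (hf.derivWithin (uniqueDiffOn_Ico 0 ε) hmn).congr fun x hx => ?_
  refine derivWithin_congr_set ?_
  filter_upwards [Iio_mem_nhds hx.2] with y hy
  exact propext ⟨fun h => ⟨h, hy⟩, fun h => h.1⟩

theorem DifferentiableOn.hasDerivWithinAt_Ici_of_Ico {f : ℝ → ℝ} {ε x : ℝ}
    (hf : DifferentiableOn ℝ f (Ico 0 ε)) (hx : x ∈ Ico 0 ε) :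
    HasDerivWithinAt f (derivWithin f (Ici 0) x) (Ici 0) x := by
  refine DifferentiableWithinAt.hasDerivWithinAt ((hf x hx).mono_of_mem_nhdsWithin ?_)
  filter_upwards [self_mem_nhdsWithin, mem_nhdsWithin_of_mem_nhds (Iio_mem_nhds hx.2)]
    with y hy hy' using ⟨hy, hy'⟩

/-- The operator `f ↦ (r f')'` applied to a function of `r²`. -/
theorem deriv_mul_deriv_comp_sq {L L₁ : ℝ → ℝ} {L₂ r : ℝ}
    (hL : ∀ᶠ s in 𝓝 (r ^ 2), HasDerivAt L (L₁ s) s) (hL₁ : HasDerivAt L₁ L₂ (r ^ 2)) :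
    deriv (fun x => x * deriv (fun t => L (t ^ 2)) x) r
      = 4 * r * L₁ (r ^ 2) + 4 * r ^ 3 * L₂ := by
  have hsq (x : ℝ) : HasDerivAt (fun t : ℝ => t ^ 2) (2 * x) x := by
    simpa using hasDerivAt_pow 2 x
  have hev : (fun x => x * deriv (fun t => L (t ^ 2)) x)
      =ᶠ[𝓝 r] fun x => 2 * x ^ 2 * L₁ (x ^ 2) := by
    filter_upwards [(hsq r).continuousAt.eventually hL] with x hx
    have h : HasDerivAt (fun t => L (t ^ 2)) (L₁ (x ^ 2) * (2 * x)) x :=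
      HasDerivAt.comp (h := fun t : ℝ => t ^ 2) x hx (hsq x)
    rw [h.deriv]
    ring
  have h₁ : HasDerivAt (fun x => L₁ (x ^ 2)) (L₂ * (2 * r)) r :=
    HasDerivAt.comp (h := fun t : ℝ => t ^ 2) r hL₁ (hsq r)
  rw [hev.deriv_eq]
  refine (((hsq r).const_mul 2).mul h₁).deriv.trans ?_
  ring

/-- **Small-`r` expansion coefficients for the quartic potential (α = 2)**
(eqs. (43)-(44) of Akemann–Byun): if `g(r) = G(r²)` is positive, `C²` up to `0`, and solves
the Freud radial mean field equation `4πc r g = 8r³ + (r (log g)')'` near the origin, then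
the first two Taylor coefficients of `log(g/g(0))` in the variable `r²` are
`a₁ = πc g(0)` and `a₂ = ¼(πc g(0))² - 1/2`. -/
theorem freud_small_r_coefficients_alpha_two (c ε : ℝ) (hε : 0 < ε) (G : ℝ → ℝ)
    (hG : ContDiffOn ℝ 2 G (Set.Ico 0 ε))
    (hGpos : ∀ s ∈ Set.Ico (0 : ℝ) ε, 0 < G s)
    (hODE : ∀ r ∈ Set.Ioo 0 (Real.sqrt ε),
      4 * Real.pi * c * (r * G (r ^ 2))
        = 8 * r ^ 3 + deriv (fun x => x * deriv (fun t => Real.log (G (t ^ 2))) x) r) :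
    derivWithin (fun s => Real.log (G s)) (Set.Ici 0) 0
        = Real.pi * c * G 0
      ∧ (1 / 2 : ℝ) * derivWithin
            (derivWithin (fun s => Real.log (G s)) (Set.Ici 0)) (Set.Ici 0) 0
        = (1 / 4) * (Real.pi * c * G 0) ^ 2 - 1 / 2 := by
  have h0 : (0 : ℝ) ∈ Ico 0 ε := ⟨le_rfl, hε⟩
  set L : ℝ → ℝ := fun s => Real.log (G s)
  set L₁ := derivWithin L (Ici 0)
  set L₂ := derivWithin L₁ (Ici 0)
  have hL : ContDiffOn ℝ 2 L (Ico 0 ε) := hG.log fun s hs => (hGpos s hs).ne'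
  have hL₁ : ContDiffOn ℝ 1 L₁ (Ico 0 ε) :=
    hL.derivWithin_Ici_of_Ico (by norm_num [one_add_one_eq_two])
  have hL₂ : ContinuousOn L₂ (Ico 0 ε) :=
    (hL₁.derivWithin_Ici_of_Ico (m := 0) (by norm_num)).continuousOn
  have dG := (hG.differentiableOn (by norm_num)).hasDerivWithinAt_Ici_of_Ico h0
  have dL {s : ℝ} (hs : s ∈ Ico 0 ε) : HasDerivWithinAt L (L₁ s) (Ici 0) s :=
    (hL.differentiableOn (by norm_num)).hasDerivWithinAt_Ici_of_Ico hs
  have dL₁ {s : ℝ} (hs : s ∈ Ico 0 ε) : HasDerivWithinAt L₁ (L₂ s) (Ici 0) s :=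
    (hL₁.differentiableOn (by norm_num)).hasDerivWithinAt_Ici_of_Ico hs
  have ode : ∀ s ∈ Ioo 0 ε, Real.pi * c * G s = 2 * s + L₁ s + s * L₂ s := by
    intro s hs
    have hr : 0 < Real.sqrt s := Real.sqrt_pos.2 hs.1
    have hsq : Real.sqrt s ^ 2 = s := Real.sq_sqrt hs.1.le
    have h := hODE (Real.sqrt s) ⟨hr, Real.sqrt_lt_sqrt hs.1.le hs.2⟩
    have hd : ∀ᶠ u in 𝓝 (Real.sqrt s ^ 2), HasDerivAt L (L₁ u) u := by
      rw [hsq]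
      filter_upwards [Ioo_mem_nhds hs.1 hs.2] with u hu
      exact (dL (Ioo_subset_Ico_self hu)).hasDerivAt (Ici_mem_nhds hu.1)
    have hd₁ : HasDerivAt L₁ (L₂ s) (Real.sqrt s ^ 2) := by
      rw [hsq]
      exact (dL₁ (Ioo_subset_Ico_self hs)).hasDerivAt (Ici_mem_nhds hs.1)
    rw [deriv_mul_deriv_comp_sq hd hd₁, pow_succ _ 2, hsq] at h
    refine mul_left_cancel₀ (mul_pos four_pos hr).ne' ?_
    linear_combination h
  have hmem : Ioo 0 ε ∈ 𝓝[>] (0 : ℝ) := Ioo_mem_nhdsGT hε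
  have lim {f : ℝ → ℝ} (hf : ContinuousOn f (Ico 0 ε)) : Tendsto f (𝓝[>] 0) (𝓝 (f 0)) :=
    (hf 0 h0).mono_left (nhdsWithin_le_of_mem (mem_of_superset hmem Ioo_subset_Ico_self))
  have lid : Tendsto (fun s : ℝ => s) (𝓝[>] 0) (𝓝 0) := lim continuousOn_id
  have e₁ : L₁ 0 = Real.pi * c * G 0 := by
    have hr := ((lid.const_mul 2).add (lim hL₁.continuousOn)).add (lid.mul (lim hL₂))
    have hl := (lim hG.continuousOn).const_mul (Real.pi * c)
    have := tendsto_nhds_unique (hl.congr' (by filter_upwards [hmem] with s hs using ode s hs)) hr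
    linarith
  have e₂ : derivWithin G (Ici 0) 0 = G 0 * L₁ 0 := by
    have h := (dG.log (hGpos 0 h0).ne').derivWithin (uniqueDiffOn_Ici 0 0 self_mem_Ici)
    have h' : L₁ 0 = derivWithin G (Ici 0) 0 / G 0 := h
    rw [h', mul_div_cancel₀ _ (hGpos 0 h0).ne']
  have e₃ : 2 * L₂ 0 = Real.pi * c * derivWithin G (Ici 0) 0 - 2 := by
    have slope_lim {f : ℝ → ℝ} {f' : ℝ} (hf : HasDerivWithinAt f f' (Ici 0) 0) :
        Tendsto (slope f 0) (𝓝[>] 0) (𝓝 f') :=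
      (hasDerivWithinAt_iff_tendsto_slope' self_notMem_Ioi).1 hf.Ioi_of_Ici
    have hl := (slope_lim (dL₁ h0)).add (lim hL₂)
    have hr := ((slope_lim dG).const_mul (Real.pi * c)).sub_const 2
    have := tendsto_nhds_unique (hl.congr' ?_) hr
    · linarith
    filter_upwards [hmem] with s hs
    have hs0 := hs.1.ne'
    simp only [slope_def_field, sub_zero]
    field_simp
    linear_combination -e₁ - ode s hs
  refine ⟨e₁, ?_⟩
  rw [e₂, e₁] at e₃
  linear_combination e₃ / 4
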